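/- Let Ĥ be a symmetric n×n real matrix and G an m×n real matrix such that: (i) yᵀĤy ≥ γ_H‖y‖² for all y with Gy = 0; (ii) GGᵀ ⪰ γ_G I; (iii) ‖Ĥ‖ ≤ Υ, where Υ ≥ 1, 0 < γ_H ≤ 1, and 0 < γ_G ≤ 1. Then for every x ∈ ℝⁿ, xᵀĤx ≥ (γ_H/2)‖x‖² − (3.5Υ²/(γ_H γ_G))‖Gx‖². -/

import Mathlib

open Matrix

/-- The spectral (ℓ²-operator) norm of a real matrix. -/
noncomputable def specNorm {α β : Type*} [Fintype α] [Fintype β] [DecidableEq β]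
    (A : Matrix α β ℝ) : ℝ :=
  ‖LinearMap.toContinuousLinearMap (Matrix.toEuclideanLin A)‖

theorem dotProduct_self_nonneg {α : Type*} [Fintype α] (v : α → ℝ) : 0 ≤ v ⬝ᵥ v :=
  Finset.sum_nonneg fun i _ => mul_self_nonneg (v i)

/-- Expansion of `0 ≤ ‖t u + v‖²`. -/
theorem sq_combination_nonneg {α : Type*} [Fintype α] (t : ℝ) (u v : α → ℝ) :
    0 ≤ t ^ 2 * (u ⬝ᵥ u) + 2 * t * (u ⬝ᵥ v) + v ⬝ᵥ v := by
  have h := dotProduct_self_nonneg (t • u + v)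
  simp only [add_dotProduct, dotProduct_add, smul_dotProduct, dotProduct_smul, smul_eq_mul,
    dotProduct_comm v u] at h
  linarith

/-- A coercive square matrix acts surjectively on vectors. -/
theorem exists_mulVec_eq_of_coercive {α : Type*} [Fintype α] [DecidableEq α] {γ : ℝ}
    (hγ : 0 < γ) {M : Matrix α α ℝ} (hM : ∀ v : α → ℝ, γ * (v ⬝ᵥ v) ≤ v ⬝ᵥ M *ᵥ v)
    (b : α → ℝ) : ∃ w, M *ᵥ w = b := by
  refine mulVec_surjective_iff_isUnit.2 (mulVec_injective_iff_isUnit.1 fun u v huv => ?_) b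
  have h := hM (u - v)
  rw [mulVec_sub, sub_eq_zero.2 huv, dotProduct_zero] at h
  have h0 : (u - v) ⬝ᵥ (u - v) = 0 :=
    le_antisymm (nonpos_of_mul_nonpos_right h hγ) (dotProduct_self_nonneg _)
  exact sub_eq_zero.1 (dotProduct_self_eq_zero.1 h0)

theorem mulVec_dotProduct_self_le {α β : Type*} [Fintype α] [Fintype β] [DecidableEq β]
    {A : Matrix α β ℝ} {C : ℝ} (hA : specNorm A ≤ C) (v : β → ℝ) :
    (A *ᵥ v) ⬝ᵥ (A *ᵥ v) ≤ C ^ 2 * (v ⬝ᵥ v) := by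
  have h := (LinearMap.toContinuousLinearMap (Matrix.toEuclideanLin A)).le_of_opNorm_le hA
    (WithLp.toLp 2 v)
  have h2 := pow_le_pow_left₀ (norm_nonneg _) h 2
  rw [mul_pow, EuclideanSpace.real_norm_sq_eq, EuclideanSpace.real_norm_sq_eq] at h2
  simpa [dotProduct, sq] using h2

/-- `xᵀ Ĥ x ≥ (γ_H/2)‖x‖² − (3.5 Υ²/(γ_H γ_G))‖Gx‖²` for every `x`. -/
theorem hessian_lower_bound (n m : ℕ) (γH γG Υ : ℝ)
    (hγH : 0 < γH) (hγH1 : γH ≤ 1) (hγG : 0 < γG) (hγG1 : γG ≤ 1) (hΥ : 1 ≤ Υ)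
    (Hh : Matrix (Fin n) (Fin n) ℝ) (G : Matrix (Fin m) (Fin n) ℝ)
    (hsymm : Hh.IsSymm)
    (hred : ∀ y : Fin n → ℝ, G.mulVec y = 0 → γH * (y ⬝ᵥ y) ≤ y ⬝ᵥ Hh.mulVec y)
    (hGG : ∀ y : Fin m → ℝ, γG * (y ⬝ᵥ y) ≤ y ⬝ᵥ (G * Gᵀ).mulVec y)
    (hHn : specNorm Hh ≤ Υ) :
    ∀ x : Fin n → ℝ,
      (γH / 2) * (x ⬝ᵥ x) - (3.5 * Υ ^ 2 / (γH * γG)) * (G.mulVec x ⬝ᵥ G.mulVec x) ≤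
        x ⬝ᵥ Hh.mulVec x := by
  intro x
  obtain ⟨w, hw⟩ := exists_mulVec_eq_of_coercive hγG hGG (G *ᵥ x)
  set z := Gᵀ *ᵥ w with hz
  have hGz : G *ᵥ z = G *ᵥ x := by rw [hz, mulVec_mulVec, hw]
  obtain ⟨y, hy⟩ : ∃ y, y = x - z := ⟨_, rfl⟩
  have hGy : G *ᵥ y = 0 := by rw [hy, mulVec_sub, hGz, sub_self]
  have hx : x = y + z := by rw [hy]; abel
  have hyz : y ⬝ᵥ z = 0 := by
    rw [hz, dotProduct_mulVec, vecMul_transpose, hGy, zero_dotProduct]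
  have hwz : (G *ᵥ x) ⬝ᵥ w = z ⬝ᵥ z := by
    rw [← hGz, ← vecMul_transpose, ← dotProduct_mulVec]
  have hz_le : γG * (z ⬝ᵥ z) ≤ (G *ᵥ x) ⬝ᵥ (G *ᵥ x) := by
    have h1 := sq_combination_nonneg (-γG) w (G *ᵥ x)
    have h2 := hGG w
    rw [hw, dotProduct_comm w (G *ᵥ x), hwz] at h2
    rw [dotProduct_comm w (G *ᵥ x), hwz] at h1
    nlinarith
  have hHz : (Hh *ᵥ z) ⬝ᵥ (Hh *ᵥ z) ≤ Υ ^ 2 * (z ⬝ᵥ z) :=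
    mulVec_dotProduct_self_le hHn z
  have hyHy := hred y hGy
  have hyHz := sq_combination_nonneg (γH / 2) y (Hh *ᵥ z)
  have hzHz := sq_combination_nonneg Υ z (Hh *ᵥ z)
  have hzHy : z ⬝ᵥ Hh *ᵥ y = y ⬝ᵥ Hh *ᵥ z := by
    rw [dotProduct_mulVec, ← mulVec_transpose, hsymm.eq, dotProduct_comm]
  have hxx : x ⬝ᵥ x = y ⬝ᵥ y + z ⬝ᵥ z := by
    rw [hx, add_dotProduct, dotProduct_add, dotProduct_add, dotProduct_comm z y, hyz]
    ring
  have hxHx : x ⬝ᵥ Hh *ᵥ x = y ⬝ᵥ Hh *ᵥ y + 2 * (y ⬝ᵥ Hh *ᵥ z) + z ⬝ᵥ Hh *ᵥ z := by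
    rw [hx, mulVec_add, add_dotProduct, dotProduct_add, dotProduct_add, hzHy]
    ring
  have hzz : 0 ≤ z ⬝ᵥ z := dotProduct_self_nonneg z
  have hpen : 3.5 * Υ ^ 2 / γH * (z ⬝ᵥ z)
      ≤ 3.5 * Υ ^ 2 / (γH * γG) * (G *ᵥ x ⬝ᵥ G *ᵥ x) := by
    calc 3.5 * Υ ^ 2 / γH * (z ⬝ᵥ z)
        = 3.5 * Υ ^ 2 / (γH * γG) * (γG * (z ⬝ᵥ z)) := by field_simp
      _ ≤ _ := by gcongr
  refine (sub_le_sub_left hpen _).trans ?_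
  rw [hxx, hxHx]
  generalize y ⬝ᵥ y = a at *
  generalize z ⬝ᵥ z = b at *
  generalize y ⬝ᵥ Hh *ᵥ z = c at *
  generalize z ⬝ᵥ Hh *ᵥ z = d at *
  have hd : -(Υ * b) ≤ d := by
    have : 0 ≤ 2 * Υ * (Υ * b + d) := by nlinarith
    have := nonneg_of_mul_nonneg_right this (by linarith)
    linarith
  have hc : -(γH / 2 * a + 2 * Υ ^ 2 / γH * b) ≤ 2 * c := by
    have h : 0 ≤ γH / 2 * (γH / 2 * a + 2 * Υ ^ 2 / γH * b + 2 * c) := by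
      have : γH / 2 * (γH / 2 * a + 2 * Υ ^ 2 / γH * b + 2 * c)
          = γH ^ 2 / 4 * a + Υ ^ 2 * b + γH * c := by field_simp; ring
      rw [this]; nlinarith
    have := nonneg_of_mul_nonneg_right h (by linarith)
    linarith
  have hq : Υ ≤ Υ ^ 2 / γH := by
    rw [le_div_iff₀ hγH]; nlinarith
  have h3 : 2 * Υ ^ 2 / γH = 2 * (Υ ^ 2 / γH) := by ring
  have h4 : 3.5 * Υ ^ 2 / γH = 3.5 * (Υ ^ 2 / γH) := by ring
  rw [h3] at hc
  rw [h4]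
  have h5 : 0 ≤ (1.5 * (Υ ^ 2 / γH) - Υ - γH / 2) * b :=
    mul_nonneg (by norm_num; linarith) hzz
  norm_num at h5 ⊢
  linarith
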